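/- Let Γ be a group such that the center Z(Γ) has index exactly 4 in Γ, and let π be a topologically irreducible unitary representation of Γ on a complex Hilbert space H. Then H is finite-dimensional and dim_ℂ H ≤ 2. -/

import Mathlib

/-- The Schur lemma for a topologically irreducible family of operators: a normal operator which,
together with its adjoint, commutes with the family is a scalar. -/
theorem exists_eq_smul_one_of_isStarNormal_of_irreducible {H : Type*} [NormedAddCommGroup H]
    [InnerProductSpace ℂ H] [CompleteSpace H] [Nontrivial H] {ι : Type*} {S : ι → H →L[ℂ] H}
    (hirr : ∀ U : Submodule ℂ H, IsClosed (U : Set H) →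
      (∀ i, ∀ v ∈ U, S i v ∈ U) → U = ⊥ ∨ U = ⊤)
    {T : H →L[ℂ] H} (hT : IsStarNormal T) (hcomm : ∀ i, Commute T (S i))
    (hcomm_star : ∀ i, Commute (star T) (S i)) :
    ∃ c : ℂ, T = c • 1 := by
  obtain ⟨a, ha⟩ := spectrum.nonempty T
  have hsub : ∀ b ∈ spectrum ℂ T, b = a := by
    intro b hb
    by_contra hab
    have hd : 0 < dist a b := dist_pos.mpr (Ne.symm hab)
    -- Two functions with product zero, supported near `a` and near `b` respectively.
    let f : ℂ → ℂ := fun x => ((max 0 (dist x b - dist x a) : ℝ) : ℂ)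
    let g : ℂ → ℂ := fun x => ((max 0 (dist x a - dist x b) : ℝ) : ℂ)
    have hf : Continuous f := by fun_prop
    have hg : Continuous g := by fun_prop
    have hfg : ∀ x, f x * g x = 0 := by
      intro x
      simp only [f, g]
      rcases le_total (dist x a) (dist x b) with hx | hx
      · rw [max_eq_left (sub_nonpos.mpr hx) (b := dist x a - dist x b)]; simp
      · rw [max_eq_left (sub_nonpos.mpr hx) (b := dist x b - dist x a)]; simp
    have hne : ∀ {k : ℂ → ℂ}, Continuous k → ∀ x ∈ spectrum ℂ T, k x ≠ 0 → cfc k T ≠ 0 := by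
      intro k hk x hx hkx h0
      have hmem : k x ∈ spectrum ℂ (cfc k T) := by
        rw [cfc_map_spectrum k T hT hk.continuousOn]
        exact ⟨x, hx, rfl⟩
      rw [h0, spectrum.zero_eq] at hmem
      exact hkx hmem
    have hfne : cfc f T ≠ 0 := hne hf a ha (by simpa [f] using hab ∘ Eq.symm)
    have hgne : cfc g T ≠ 0 := hne hg b hb (by simpa [g] using hab)
    have hmul : cfc f T * cfc g T = 0 := by
      rw [← cfc_mul f g T hf.continuousOn hg.continuousOn]
      simp [hfg]
    rcases hirr (LinearMap.ker (cfc f T).toLinearMap) (cfc f T).isClosed_ker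
      (fun i v hv => by
        have hc := DFunLike.congr_fun ((hcomm i).cfc (hcomm_star i) f).eq v
        simp only [mul_apply_eq_comp] at hc
        simp only [LinearMap.mem_ker, ContinuousLinearMap.coe_coe] at hv ⊢
        rw [hc, hv, map_zero]) with hU | hU
    · refine hgne (ContinuousLinearMap.ext fun v => ?_)
      have hv : cfc g T v ∈ LinearMap.ker (cfc f T).toLinearMap :=
        DFunLike.congr_fun hmul v
      rw [hU] at hv
      exact hv
    · refine hfne (ContinuousLinearMap.ext fun v => ?_)
      have hv : v ∈ LinearMap.ker (cfc f T).toLinearMap := hU ▸ Submodule.mem_top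
      exact hv
  refine ⟨a, ?_⟩
  calc T = cfc (id : ℂ → ℂ) T := (cfc_id ℂ T).symm
    _ = cfc (fun _ => a) T := cfc_congr hsub
    _ = a • 1 := by rw [cfc_const a T, Algebra.algebraMap_eq_smul_one]

/-- An endomorphism whose square is a scalar has an eigenvector. -/
theorem exists_eigenvector_of_apply_apply_eq_smul {V : Type*} [AddCommGroup V] [Module ℂ V]
    [Nontrivial V] {T : V →ₗ[ℂ] V} {c : ℂ} (hT : ∀ v, T (T v) = c • v) :
    ∃ v ≠ 0, ∃ s : ℂ, T v = s • v := by
  obtain ⟨s, hs⟩ := IsAlgClosed.exists_pow_nat_eq c two_pos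
  obtain ⟨w, hw⟩ := exists_ne (0 : V)
  by_cases h : T w = s • w
  · exact ⟨w, hw, s, h⟩
  · refine ⟨T w - s • w, sub_ne_zero.mpr h, -s, ?_⟩
    rw [map_sub, map_smul, hT, ← hs]
    module

/-- If the centre has index 4, then it has index 2 in the centralizer of any noncentral element,
and that centralizer has index 2. -/
theorem index_centralizer_eq_two_of_index_center_eq_four {Γ : Type*} [Group Γ]
    (h : (Subgroup.center Γ).index = 4) {g : Γ} (hg : g ∉ Subgroup.center Γ) :
    (Subgroup.center Γ).relIndex (Subgroup.centralizer {g}) = 2 ∧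
      (Subgroup.centralizer {g}).index = 2 := by
  have hmul := Subgroup.relIndex_mul_index (Subgroup.center_le_centralizer ({g} : Set Γ))
  rw [h] at hmul
  have h₁ : (Subgroup.center Γ).relIndex (Subgroup.centralizer {g}) ≠ 1 := by
    rw [Ne, Subgroup.relIndex_eq_one]
    exact fun hle => hg (hle (Subgroup.mem_centralizer_singleton_iff.mpr rfl))
  have h₂ : (Subgroup.centralizer {g}).index ≠ 1 := by
    rw [Ne, Subgroup.index_eq_one, Subgroup.centralizer_eq_top_iff_subset]
    simpa using hg
  have hdvd : (Subgroup.centralizer {g}).index ∣ 4 := Dvd.intro_left _ hmul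
  have hle := Nat.le_of_dvd (by norm_num) hdvd
  interval_cases (Subgroup.centralizer {g}).index <;> omega

/-- If the centre of `Γ` has index exactly 4, then every topologically irreducible unitary
representation of `Γ` on a complex Hilbert space `H` forces `H` to be finite-dimensional of
dimension at most 2. -/
theorem finrank_le_two_of_index_center_eq_four {Γ : Type*} [Group Γ]
    (h : (Subgroup.center Γ).index = 4)
    {H : Type*} [NormedAddCommGroup H] [InnerProductSpace ℂ H] [CompleteSpace H]
    (π : Γ →* unitary (H →L[ℂ] H))
    (hirr : ∀ U : Submodule ℂ H, IsClosed (U : Set H) →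
      (∀ g : Γ, ∀ v ∈ U, (π g : H →L[ℂ] H) v ∈ U) → U = ⊥ ∨ U = ⊤) :
    FiniteDimensional ℂ H ∧ Module.finrank ℂ H ≤ 2 := by
  have hfin : ∀ v w : H, Submodule.span ℂ {v, w} = ⊤ →
      FiniteDimensional ℂ H ∧ Module.finrank ℂ H ≤ 2 := by
    intro v w hvw
    have hfd : FiniteDimensional ℂ H :=
      Module.finite_def.mpr (hvw ▸ Submodule.fg_span (Set.toFinite {v, w}))
    refine ⟨hfd, ?_⟩
    classical
    have hcard := finrank_span_finset_le_card (R := ℂ) ({v, w} : Finset H)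
    rw [Finset.coe_pair, Set.finrank, hvw, finrank_top] at hcard
    exact hcard.trans Finset.card_le_two
  rcases subsingleton_or_nontrivial H with hH | hH
  · exact hfin 0 0 (Subsingleton.elim _ _)
  have hmul : ∀ (a b : Γ) (v : H),
      (π (a * b) : H →L[ℂ] H) v = (π a : H →L[ℂ] H) ((π b : H →L[ℂ] H) v) := by
    intro a b v
    rw [map_mul]
    rfl
  have hscalar : ∀ z ∈ Subgroup.center Γ, ∃ c : ℂ, (π z : H →L[ℂ] H) = c • 1 := by
    intro z hz
    have hcomm : ∀ y ∈ Subgroup.center Γ, ∀ x,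
        Commute (π y : H →L[ℂ] H) (π x : H →L[ℂ] H) := by
      intro y hy x
      have hyx := congrArg (fun t => (π t : H →L[ℂ] H)) (Subgroup.mem_center_iff.mp hy x)
      simp only [map_mul] at hyx
      exact hyx.symm
    refine exists_eq_smul_one_of_isStarNormal_of_irreducible hirr ⟨?_⟩ (hcomm z hz) fun x => ?_
    · exact (Unitary.star_mul_self_of_mem (π z).2).trans (Unitary.mul_star_self_of_mem (π z).2).symm
    · have hinv := hcomm z⁻¹ (inv_mem hz) x
      rwa [map_inv, ← Unitary.star_eq_inv] at hinv
  obtain ⟨g, hg⟩ : ∃ g, g ∉ Subgroup.center Γ := by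
    by_contra! hall
    rw [Subgroup.index_eq_one.mpr (eq_top_iff.mpr fun x _ => hall x)] at h
    norm_num at h
  obtain ⟨hrel, hidx⟩ := index_centralizer_eq_two_of_index_center_eq_four h hg
  have hgA : g ∈ Subgroup.centralizer {g} := Subgroup.mem_centralizer_singleton_iff.mpr rfl
  have hcoset : ∀ a ∈ Subgroup.centralizer {g},
      a ∈ Subgroup.center Γ ∨ g⁻¹ * a ∈ Subgroup.center Γ := by
    intro a ha
    have hiff := Subgroup.mul_mem_iff_of_index_two (H := (Subgroup.center Γ).subgroupOf _) hrel
      (a := ⟨g⁻¹, inv_mem hgA⟩) (b := ⟨a, ha⟩)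
    simp only [Subgroup.mem_subgroupOf, Subgroup.coe_mul, inv_mem_iff, hg, false_iff] at hiff
    tauto
  obtain ⟨k, hk⟩ : ∃ k, k ∉ Subgroup.centralizer {g} := by
    by_contra! hall
    rw [Subgroup.index_eq_one.mpr (eq_top_iff.mpr fun x _ => hall x)] at hidx
    norm_num at hidx
  have hsq : g * g ∈ Subgroup.center Γ := by
    rcases hcoset _ (mul_mem hgA hgA) with hz | hz
    · exact hz
    · exact absurd (by simpa using hz) hg
  obtain ⟨c, hc⟩ := hscalar _ hsq
  obtain ⟨v, hv, s, hs⟩ := exists_eigenvector_of_apply_apply_eq_smul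
    (T := (π g : H →L[ℂ] H).toLinearMap) (c := c) fun w => by
      have hw := DFunLike.congr_fun hc w
      rw [hmul] at hw
      simpa using hw
  have hs : (π g : H →L[ℂ] H) v = s • v := hs
  have hline : ∀ a ∈ Subgroup.centralizer {g}, ∃ r : ℂ, (π a : H →L[ℂ] H) v = r • v := by
    intro a ha
    rcases hcoset a ha with hz | hz
    · obtain ⟨r, hr⟩ := hscalar _ hz
      exact ⟨r, by simp [hr]⟩
    · obtain ⟨r, hr⟩ := hscalar _ hz
      refine ⟨r * s, ?_⟩
      rw [← mul_inv_cancel_left g a, hmul, hr]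
      simp [hs, mul_smul]
  have horbit : ∀ x, (π x : H →L[ℂ] H) v ∈ Submodule.span ℂ {v, (π k : H →L[ℂ] H) v} := by
    intro x
    by_cases hx : x ∈ Subgroup.centralizer {g}
    · obtain ⟨r, hr⟩ := hline x hx
      rw [hr]
      exact Submodule.smul_mem _ _ (Submodule.subset_span (by simp))
    · have hkx : k⁻¹ * x ∈ Subgroup.centralizer {g} := by
        rw [Subgroup.mul_mem_iff_of_index_two hidx, inv_mem_iff]
        tauto
      obtain ⟨r, hr⟩ := hline _ hkx
      rw [← mul_inv_cancel_left k x, hmul, hr, map_smul]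
      exact Submodule.smul_mem _ _ (Submodule.subset_span (by simp))
  refine hfin v ((π k : H →L[ℂ] H) v) ((hirr _ ?_ ?_).resolve_left ?_)
  · have : FiniteDimensional ℂ (Submodule.span ℂ {v, (π k : H →L[ℂ] H) v}) :=
      FiniteDimensional.span_of_finite ℂ (Set.toFinite _)
    exact Submodule.closed_of_finiteDimensional _
  · intro x w hw
    obtain ⟨p, q, rfl⟩ := Submodule.mem_span_pair.mp hw
    rw [map_add, map_smul, map_smul, ← hmul]
    exact add_mem (Submodule.smul_mem _ _ (horbit x)) (Submodule.smul_mem _ _ (horbit (x * k)))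
  · intro hbot
    have hmem : v ∈ Submodule.span ℂ {v, (π k : H →L[ℂ] H) v} :=
      Submodule.subset_span (by simp)
    rw [hbot] at hmem
    exact hv hmem
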